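/- arXiv:1412.6293 — 7 statements merged into one kernel-verified Lean document; each statement's English description precedes it below -/
import Mathlib

section
/- Let f_i : ℝ^d → ℝ be a differentiable convex function and let j ∈ {1,…,d} and L_{ij} ≥ 0 be such that f_i(x + h e_j) ≤ f_i(x) + ⟨∇f_i(x), h e_j⟩ + (L_{ij}/2) h² for all x ∈ ℝ^d and h ∈ ℝ. Then for all x, y ∈ ℝ^d: (∇_j f_i(x) − ∇_j f_i(y))² ≤ 2 L_{ij} ( f_i(x) − f_i(y) − ⟨∇f_i(y), x − y⟩ ). -/
open RealInnerProductSpace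

theorem grad_ineq_aux {d : ℕ} (f : EuclideanSpace ℝ (Fin d) → ℝ)
    (hdiff : Differentiable ℝ f) (hconv : ConvexOn ℝ Set.univ f)
    (y z : EuclideanSpace ℝ (Fin d)) :
    f y + ⟪gradient f y, z - y⟫ ≤ f z := by
  have hc : ConvexOn ℝ Set.univ (f ∘ (AffineMap.lineMap y z : ℝ →ᵃ[ℝ] _)) := by
    simpa using hconv.comp_affineMap (AffineMap.lineMap y z : ℝ →ᵃ[ℝ] _)
  have hg : HasFDerivAt f (InnerProductSpace.toDual ℝ _ (gradient f y))
      (AffineMap.lineMap y z (0 : ℝ)) := by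
    simpa using (hdiff y).hasGradientAt.hasFDerivAt
  have hd := hg.comp_hasDerivAt (0 : ℝ) (AffineMap.hasDerivAt_lineMap (a := y) (b := z))
  have := hc.le_slope_of_hasDerivAt (Set.mem_univ 0) (Set.mem_univ 1) one_pos hd
  rw [InnerProductSpace.toDual_apply_apply] at this
  simp only [slope_def_field, Function.comp, AffineMap.lineMap_apply_one, AffineMap.lineMap_apply_zero, sub_zero, div_one] at this
  linarith

/-- Coordinate co-coercivity (Lemma 4 of the paper): if the differentiable convex
function `fi` satisfies the coordinate-wise quadratic upper bound with constant
`Lij ≥ 0` in coordinate `j`, then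
`(∇_j fi x − ∇_j fi y)² ≤ 2 Lij (fi x − fi y − ⟨∇fi y, x − y⟩)`. -/
theorem stmt0 {d : ℕ} (fi : EuclideanSpace ℝ (Fin d) → ℝ)
    (hdiff : Differentiable ℝ fi) (hconv : ConvexOn ℝ Set.univ fi)
    (j : Fin d) (Lij : ℝ) (hLij : 0 ≤ Lij)
    (hsmooth : ∀ (x : EuclideanSpace ℝ (Fin d)) (h : ℝ),
      fi (x + h • EuclideanSpace.single j 1) ≤
        fi x + ⟪gradient fi x, h • EuclideanSpace.single j 1⟫ + Lij / 2 * h ^ 2)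
    (x y : EuclideanSpace ℝ (Fin d)) :
    (gradient fi x j - gradient fi y j) ^ 2 ≤
      2 * Lij * (fi x - fi y - ⟪gradient fi y, x - y⟫) := by
  have key : ∀ h : ℝ, 0 ≤ Lij / 2 * (h * h) + (gradient fi x j - gradient fi y j) * h
      + (fi x - fi y - ⟪gradient fi y, x - y⟫) := by
    intro h
    have h1 := grad_ineq_aux fi hdiff hconv y (x + h • EuclideanSpace.single j 1)
    have h2 := hsmooth x h
    have e : x + h • EuclideanSpace.single j (1 : ℝ) - y
        = (x - y) + h • EuclideanSpace.single j (1 : ℝ) := by abel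
    rw [e, inner_add_right, inner_smul_right, EuclideanSpace.inner_single_right] at h1
    rw [inner_smul_right, EuclideanSpace.inner_single_right] at h2
    simp only [conj_trivial, one_mul, mul_one] at h1 h2
    nlinarith
  have := discrim_le_zero key
  unfold discrim at this
  linarith
end

section
/- Let f_i : ℝ^d → ℝ be a differentiable convex function and let j ∈ {1,…,d} be such that f_i(x + h e_j) ≤ f_i(x) + ⟨∇f_i(x), h e_j⟩ for all x ∈ ℝ^d and h ∈ ℝ (i.e., the coordinate smoothness constant L_{ij} equals 0). Then the j-th partial derivative of f_i is constant: ∇_j f_i(x) = ∇_j f_i(y) for all x, y ∈ ℝ^d. -/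
open RealInnerProductSpace

theorem first_order_aux {d : ℕ} (fi : EuclideanSpace ℝ (Fin d) → ℝ)
    (hdiff : Differentiable ℝ fi) (hconv : ConvexOn ℝ Set.univ fi)
    (x z : EuclideanSpace ℝ (Fin d)) : fi x + ⟪gradient fi x, z - x⟫ ≤ fi z := by
  have hc : ConvexOn ℝ Set.univ (fi ∘ (AffineMap.lineMap x z : ℝ →ᵃ[ℝ] _)) := by
    simpa using hconv.comp_affineMap (AffineMap.lineMap x z : ℝ →ᵃ[ℝ] _)
  have hf : HasFDerivAt fi (fderiv ℝ fi x) ((AffineMap.lineMap x z : ℝ →ᵃ[ℝ] _) 0) := by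
    simpa using (hdiff x).hasFDerivAt
  have hd := hf.comp_hasDerivAt (0 : ℝ) (AffineMap.hasDerivAt_lineMap (a := x) (b := z))
  have h := hc.le_slope_of_hasDerivAt (Set.mem_univ 0) (Set.mem_univ 1) one_pos hd
  have hg : ⟪gradient fi x, z - x⟫ = fderiv ℝ fi x (z - x) := by
    simp [gradient]
  rw [hg]
  simp [slope_def_field] at h ⊢
  linarith

/-- The special case `L_{ij} = 0` of coordinate co-coercivity: if the differentiable convex
function `fi` satisfies `fi (x + h e_j) ≤ fi x + ⟨∇fi x, h e_j⟩` for all `x` and `h`, then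
its `j`-th partial derivative is constant. -/
theorem stmt2 {d : ℕ} (fi : EuclideanSpace ℝ (Fin d) → ℝ)
    (hdiff : Differentiable ℝ fi) (hconv : ConvexOn ℝ Set.univ fi)
    (j : Fin d)
    (hsmooth : ∀ (x : EuclideanSpace ℝ (Fin d)) (h : ℝ),
      fi (x + h • EuclideanSpace.single j 1) ≤
        fi x + ⟪gradient fi x, h • EuclideanSpace.single j 1⟫)
    (x y : EuclideanSpace ℝ (Fin d)) :
    gradient fi x j = gradient fi y j := by
  have key : ∀ h : ℝ, h * (gradient fi x j - gradient fi y j) ≤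
      fi y - fi x - ⟪gradient fi x, y - x⟫ := by
    intro h
    have h1 := hsmooth y h
    have h2 := first_order_aux fi hdiff hconv x (y + h • EuclideanSpace.single j 1)
    rw [add_sub_right_comm, inner_add_right] at h2
    have e : ∀ v : EuclideanSpace ℝ (Fin d),
        ⟪v, h • EuclideanSpace.single j (1 : ℝ)⟫ = h * v j := by
      intro v
      rw [inner_smul_right, EuclideanSpace.inner_single_right]
      simp
    rw [e] at h1 h2
    linarith
  by_contra hne
  have hne' := sub_ne_zero.mpr hne
  have := key ((fi y - fi x - ⟪gradient fi x, y - x⟫ + 1) / (gradient fi x j - gradient fi y j))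
  rw [div_mul_cancel₀ _ hne'] at this
  linarith
end

section
/- Suppose f attains its minimum at x* ∈ ℝ^d, and suppose v_j > 0 for all j ∈ {1,…,d}. Fix points y, x̄ ∈ ℝ^d and for each pair (i,j) with L_{ij} > 0 define G^{ij} := ∇_j f(x̄) + (1/(n q_{ij})) ( ∇_j f_i(y) − ∇_j f_i(x̄) ) and g^{ij} := p_j^{-1} G^{ij} e_j ∈ ℝ^d. Then the expected squared norm of the stochastic gradient estimate satisfies: Σ_{j=1}^d Σ_{i : L_{ij} > 0} p_j q_{ij} ‖g^{ij}‖² ≤ 4 L̂ ( f(y) − f(x*) ) + 4 L̂ ( f(x̄) − f(x*) ), where L̂ := (1/n) Σ_{j=1}^d v_j. -/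
open RealInnerProductSpace

theorem aux_conv {E : Type*} [NormedAddCommGroup E] [InnerProductSpace ℝ E] [CompleteSpace E]
    (F : E → ℝ) (hd : Differentiable ℝ F) (hc : ConvexOn ℝ Set.univ F) (x z : E) :
    F x + ⟪gradient F x, z - x⟫ ≤ F z := by
  have hg : HasFDerivAt F (fderiv ℝ F x) x := (hd x).hasFDerivAt
  have hin : ⟪gradient F x, z - x⟫ = fderiv ℝ F x (z - x) := by
    simp [gradient]
  have hline : HasDerivAt (fun t : ℝ => x + t • (z - x)) (z - x) 0 := by
    have h1 : HasDerivAt (fun t : ℝ => t • (z - x)) ((1 : ℝ) • (z - x)) 0 :=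
      (hasDerivAt_id (0 : ℝ)).smul_const (z - x)
    simpa using h1.const_add x
  have hder : HasDerivAt (fun t : ℝ => F (x + t • (z - x))) (fderiv ℝ F x (z - x)) 0 := by
    have h2 : HasFDerivAt F (fderiv ℝ F x) (x + (0 : ℝ) • (z - x)) := by simpa using hg
    exact h2.comp_hasDerivAt 0 hline
  have hcv : ConvexOn ℝ Set.univ (fun t : ℝ => F (x + t • (z - x))) := by
    refine ⟨convex_univ, ?_⟩
    intro s _ t _ a b ha hb hab
    have h3 := hc.2 (Set.mem_univ (x + s • (z - x))) (Set.mem_univ (x + t • (z - x))) ha hb hab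
    have h4 : a • (x + s • (z - x)) + b • (x + t • (z - x)) = x + (a • s + b • t) • (z - x) := by
      have hb' : b = 1 - a := by linarith
      subst hb'
      simp only [smul_eq_mul]
      module
    rw [h4] at h3
    exact h3
  have h5 := hcv.le_slope_of_hasDerivAt (Set.mem_univ 0) (Set.mem_univ 1) (by norm_num) hder
  rw [slope_def_field] at h5
  simp at h5
  rw [hin, map_sub]; linarith

theorem aux_coco {d : ℕ} (F : EuclideanSpace ℝ (Fin d) → ℝ) (hd : Differentiable ℝ F)
    (hc : ConvexOn ℝ Set.univ F) (j : Fin d) (l : ℝ)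
    (hs : ∀ (x : EuclideanSpace ℝ (Fin d)) (h : ℝ), F (x + h • EuclideanSpace.single j 1) ≤
        F x + ⟪gradient F x, h • EuclideanSpace.single j 1⟫ + l / 2 * h ^ 2)
    (x y : EuclideanSpace ℝ (Fin d)) :
    (gradient F y j - gradient F x j) ^ 2 ≤ 2 * l * (F y - F x - ⟪gradient F x, y - x⟫) := by
  have key : ∀ h : ℝ, 0 ≤ (l / 2) * (h * h) + (gradient F y j - gradient F x j) * h
      + (F y - F x - ⟪gradient F x, y - x⟫) := by
    intro h
    have h1 := hs y h
    have h2 := aux_conv F hd hc x (y + h • EuclideanSpace.single j 1)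
    have e : y + h • (EuclideanSpace.single j 1 : EuclideanSpace ℝ (Fin d)) - x
        = (y - x) + h • EuclideanSpace.single j 1 := by abel
    rw [e, inner_add_right] at h2
    have e1 : ∀ w : EuclideanSpace ℝ (Fin d),
        ⟪w, h • (EuclideanSpace.single j 1 : EuclideanSpace ℝ (Fin d))⟫ = h * w j := by
      intro w
      rw [inner_smul_right, EuclideanSpace.inner_single_right]; simp
    rw [e1] at h1 h2
    nlinarith
  have := discrim_le_zero key
  unfold discrim at this
  linarith

theorem aux_sum {ι : Type*} (s : Finset ι) (q a b : ι → ℝ) (m N : ℝ) (hN : 0 < N)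
    (hq : ∀ i ∈ s, 0 < q i) (h1 : ∑ i ∈ s, q i = 1) (hm : ∑ i ∈ s, b i = N * m) :
    ∑ i ∈ s, q i * (m + (1 / (N * q i)) * (a i - b i)) ^ 2 ≤
      2 * ∑ i ∈ s, a i ^ 2 / (N ^ 2 * q i) + 2 * ∑ i ∈ s, b i ^ 2 / (N ^ 2 * q i) := by
  have h : ∀ i ∈ s, q i * (m + (1 / (N * q i)) * (a i - b i)) ^ 2 ≤
      2 * (a i ^ 2 / (N ^ 2 * q i)) + 2 * (b i ^ 2 / (N ^ 2 * q i))
        + (2 * m ^ 2 * q i - 4 * m / N * b i) := by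
    intro i hi
    have hqi := hq i hi
    have e : 2 * (a i ^ 2 / (N ^ 2 * q i)) + 2 * (b i ^ 2 / (N ^ 2 * q i))
        + (2 * m ^ 2 * q i - 4 * m / N * b i) - q i * (m + (1 / (N * q i)) * (a i - b i)) ^ 2
        = q i * (a i / (N * q i) - (m - b i / (N * q i))) ^ 2 := by
      field_simp
      ring
    have : 0 ≤ q i * (a i / (N * q i) - (m - b i / (N * q i))) ^ 2 := by positivity
    linarith
  refine (Finset.sum_le_sum h).trans ?_
  rw [Finset.sum_add_distrib, Finset.sum_add_distrib, Finset.sum_sub_distrib, ← Finset.mul_sum,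
    ← Finset.mul_sum, ← Finset.mul_sum, ← Finset.mul_sum, h1, hm]
  have : 4 * m / N * (N * m) = 4 * m ^ 2 := by field_simp
  rw [this]
  nlinarith [sq_nonneg m]

theorem aux_bound {n d : ℕ} (L : Fin n → Fin d → ℝ) (hL : ∀ i j, 0 ≤ L i j)
    (ω : Fin n → ℝ)
    (hω : ∀ i, ω i = ((Finset.univ.filter fun j => L i j ≠ 0).card : ℝ))
    (v : Fin d → ℝ) (hvpos : ∀ j, 0 < v j) (S N : ℝ) (hS : 0 ≤ S) (hN : 0 < N)
    (hωpos : ∀ i j, 0 < L i j → 0 < ω i)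
    (D : Fin n → ℝ) (hD : ∀ i, 0 ≤ D i)
    (a : Fin n → Fin d → ℝ) (ha : ∀ i j, a i j ^ 2 ≤ 2 * L i j * D i) :
    ∑ j, (S / v j) * ∑ i ∈ Finset.univ.filter (fun i => 0 < L i j),
      a i j ^ 2 / (N ^ 2 * (ω i * L i j / v j)) ≤ 2 * S / N ^ 2 * ∑ i, D i := by
  have h1 : ∀ j, (S / v j) * ∑ i ∈ Finset.univ.filter (fun i => 0 < L i j),
      a i j ^ 2 / (N ^ 2 * (ω i * L i j / v j)) ≤
      ∑ i ∈ Finset.univ.filter (fun i => 0 < L i j), 2 * S / N ^ 2 * (D i / ω i) := by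
    intro j
    rw [Finset.mul_sum]
    refine Finset.sum_le_sum fun i hi => ?_
    have hl : 0 < L i j := by simpa using hi
    have hw := hωpos i j hl
    have hvj := hvpos j
    have e1 : S / v j * (a i j ^ 2 / (N ^ 2 * (ω i * L i j / v j)))
        = S / (N ^ 2 * ω i * L i j) * a i j ^ 2 := by field_simp
    have e2 : 2 * S / N ^ 2 * (D i / ω i) = S / (N ^ 2 * ω i * L i j) * (2 * L i j * D i) := by
      field_simp
    rw [e1, e2]
    exact mul_le_mul_of_nonneg_left (ha i j) (by positivity)
  refine (Finset.sum_le_sum fun j _ => h1 j).trans ?_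
  simp_rw [Finset.sum_filter]
  rw [Finset.sum_comm, Finset.mul_sum]
  refine Finset.sum_le_sum fun i _ => ?_
  rw [← Finset.sum_filter, Finset.sum_const, nsmul_eq_mul]
  have e : (Finset.univ.filter fun j => 0 < L i j) = Finset.univ.filter fun j => L i j ≠ 0 := by
    ext j
    simp [(hL i j).lt_iff_ne, eq_comm]
  rw [e, ← hω i]
  have hDi := hD i
  by_cases hz : ω i = 0
  · rw [hz]; simp; positivity
  · apply le_of_eq; field_simp

/-- Lemma 1 of the paper (variance bound): the expected squared norm of the S2CD
stochastic gradient estimate satisfies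
`Σ_j Σ_{i : L_{ij} > 0} p_j q_{ij} ‖g^{ij}‖² ≤ 4 L̂ (f y − f x*) + 4 L̂ (f x̄ − f x*)`,
where `L̂ = (1/n) Σ_j v_j`. -/
theorem stmt5 {n d : ℕ} (hn : 0 < n)
    (fi : Fin n → EuclideanSpace ℝ (Fin d) → ℝ)
    (hdiff : ∀ i, Differentiable ℝ (fi i))
    (hconv : ∀ i, ConvexOn ℝ Set.univ (fi i))
    (L : Fin n → Fin d → ℝ) (hL : ∀ i j, 0 ≤ L i j)
    (hsmooth : ∀ (i : Fin n) (j : Fin d) (x : EuclideanSpace ℝ (Fin d)) (h : ℝ),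
      fi i (x + h • EuclideanSpace.single j 1) ≤
        fi i x + ⟪gradient (fi i) x, h • EuclideanSpace.single j 1⟫ + L i j / 2 * h ^ 2)
    (f : EuclideanSpace ℝ (Fin d) → ℝ)
    (hf : ∀ x, f x = (1 / n : ℝ) * ∑ i, fi i x)
    (xstar : EuclideanSpace ℝ (Fin d)) (hmin : ∀ x, f xstar ≤ f x)
    (ω : Fin n → ℝ)
    (hω : ∀ i, ω i = ((Finset.univ.filter fun j => L i j ≠ 0).card : ℝ))
    (v : Fin d → ℝ) (hv : ∀ j, v j = ∑ i, ω i * L i j)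
    (hvpos : ∀ j, 0 < v j)
    (p : Fin d → ℝ) (hp : ∀ j, p j = v j / ∑ s, v s)
    (q : Fin n → Fin d → ℝ)
    (hq : ∀ i j, 0 < L i j → q i j = ω i * L i j / v j)
    (Lhat : ℝ) (hLhat : Lhat = (1 / n : ℝ) * ∑ j, v j)
    (y xbar : EuclideanSpace ℝ (Fin d))
    (G : Fin n → Fin d → ℝ)
    (hG : ∀ i j, 0 < L i j → G i j = gradient f xbar j +
      (1 / (n * q i j)) * (gradient (fi i) y j - gradient (fi i) xbar j))
    (g : Fin n → Fin d → EuclideanSpace ℝ (Fin d))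
    (hg : ∀ i j, 0 < L i j →
      g i j = ((p j)⁻¹ * G i j) • (EuclideanSpace.single j 1 : EuclideanSpace ℝ (Fin d))) :
    ∑ j, ∑ i ∈ Finset.univ.filter (fun i => 0 < L i j), p j * q i j * ‖g i j‖ ^ 2
      ≤ 4 * Lhat * (f y - f xstar) + 4 * Lhat * (f xbar - f xstar) := by
  have hN : (0 : ℝ) < n := by exact_mod_cast hn
  have hωpos : ∀ i j, 0 < L i j → 0 < ω i := by
    intro i j h
    rw [hω]
    have : 0 < (Finset.univ.filter fun j => L i j ≠ 0).card :=
      Finset.card_pos.2 ⟨j, by simp [h.ne']⟩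
    exact_mod_cast this
  have hgrad : ∀ x, gradient f x = (1 / n : ℝ) • ∑ i, gradient (fi i) x := by
    intro x
    have h1 : HasFDerivAt f ((1 / n : ℝ) • ∑ i, fderiv ℝ (fi i) x) x := by
      have e : f = fun x => (1 / n : ℝ) * ∑ i, fi i x := funext hf
      rw [e]
      exact (HasFDerivAt.fun_sum fun i _ => (hdiff i x).hasFDerivAt).const_mul _
    simp only [gradient]
    rw [h1.fderiv, map_smulₛₗ, map_sum]
    simp
  have hgrad0 : gradient f xstar = 0 := by
    have : IsLocalMin f xstar := Filter.Eventually.of_forall hmin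
    simp [gradient, this.fderiv_eq_zero]
  have hgj : ∀ x j, gradient f x j = (1 / n : ℝ) * ∑ i, gradient (fi i) x j := by
    intro x j; rw [hgrad]; simp
  set S := ∑ s, v s with hS
  have hS0 : 0 ≤ S := Finset.sum_nonneg fun j _ => (hvpos j).le
  let D : EuclideanSpace ℝ (Fin d) → Fin n → ℝ := fun z i =>
    fi i z - fi i xstar - ⟪gradient (fi i) xstar, z - xstar⟫
  let A : EuclideanSpace ℝ (Fin d) → Fin n → Fin d → ℝ := fun z i j =>
    gradient (fi i) z j - gradient (fi i) xstar j
  have hD : ∀ z i, 0 ≤ D z i := by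
    intro z i
    have := aux_conv (fi i) (hdiff i) (hconv i) xstar z
    simp only [D]; linarith
  have hA : ∀ z i j, A z i j ^ 2 ≤ 2 * L i j * D z i := fun z i j =>
    aux_coco (fi i) (hdiff i) (hconv i) j (L i j) (hsmooth i j) xstar z
  have hDsum : ∀ z, ∑ i, D z i = n * (f z - f xstar) := by
    intro z
    have h0 : ∑ i, ⟪gradient (fi i) xstar, z - xstar⟫ = 0 := by
      rw [← sum_inner]
      have : ∑ i, gradient (fi i) xstar = 0 := by
        have h := hgrad xstar
        rw [hgrad0] at h
        exact (smul_eq_zero.1 h.symm).resolve_left (by positivity)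
      rw [this, inner_zero_left]
    simp only [D]
    rw [Finset.sum_sub_distrib, Finset.sum_sub_distrib, h0, hf, hf]
    field_simp
    ring
  have hB : ∀ z, ∑ j, (S / v j) * ∑ i ∈ Finset.univ.filter (fun i => 0 < L i j),
      A z i j ^ 2 / ((n : ℝ) ^ 2 * (ω i * L i j / v j)) ≤ 2 * Lhat * (f z - f xstar) := by
    intro z
    refine (aux_bound L hL ω hω v hvpos S n hS0 hN hωpos (D z) (hD z) (A z) (hA z)).trans ?_
    rw [hDsum, hLhat]
    apply le_of_eq; field_simp
  have hterm : ∀ j, ∑ i ∈ Finset.univ.filter (fun i => 0 < L i j), p j * q i j * ‖g i j‖ ^ 2 ≤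
      2 * ((S / v j) * ∑ i ∈ Finset.univ.filter (fun i => 0 < L i j),
        A y i j ^ 2 / ((n : ℝ) ^ 2 * (ω i * L i j / v j))) +
      2 * ((S / v j) * ∑ i ∈ Finset.univ.filter (fun i => 0 < L i j),
        A xbar i j ^ 2 / ((n : ℝ) ^ 2 * (ω i * L i j / v j))) := by
    intro j
    have hvj := hvpos j
    have hSp : 0 < S := lt_of_lt_of_le hvj
      (Finset.single_le_sum (f := v) (fun j _ => (hvpos j).le) (Finset.mem_univ j))
    have e : ∑ i ∈ Finset.univ.filter (fun i => 0 < L i j), p j * q i j * ‖g i j‖ ^ 2 =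
        (S / v j) * ∑ i ∈ Finset.univ.filter (fun i => 0 < L i j), (ω i * L i j / v j) *
          (gradient f xbar j + (1 / (n * (ω i * L i j / v j))) * (A y i j - A xbar i j)) ^ 2 := by
      rw [Finset.mul_sum]
      refine Finset.sum_congr rfl fun i hi => ?_
      have hl : 0 < L i j := by simpa using hi
      have hG' : gradient f xbar j + (1 / (n * (ω i * L i j / v j))) * (A y i j - A xbar i j)
          = G i j := by
        rw [hG i j hl, hq i j hl]; simp only [A]; ring
      rw [hG', hg i j hl, norm_smul, hq i j hl, hp j]
      simp only [EuclideanSpace.norm_single, norm_one, mul_one, Real.norm_eq_abs, sq_abs]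
      field_simp
    have hzero : ∀ i, ¬ 0 < L i j → L i j = 0 := fun i h => le_antisymm (not_lt.1 h) (hL i j)
    have hs := aux_sum (Finset.univ.filter (fun i => 0 < L i j)) (fun i => ω i * L i j / v j)
      (fun i => A y i j) (fun i => A xbar i j) (gradient f xbar j) n hN
      (by
        intro i hi
        have hl : 0 < L i j := by simpa using hi
        have := hωpos i j hl
        positivity)
      (by
        rw [← Finset.sum_div, Finset.sum_filter_of_ne, ← hv j, div_self hvj.ne']
        intro i _ hne
        by_contra h
        exact hne (by rw [hzero i h, mul_zero]))
      (by
        rw [Finset.sum_filter_of_ne]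
        · have h0 : gradient f xstar j = 0 := by rw [hgrad0]; simp
          have h1 := hgj xstar j
          have h2 := hgj xbar j
          simp only [A]
          rw [Finset.sum_sub_distrib]
          have h3 : (n : ℝ) * gradient f xbar j - n * gradient f xstar j = 
            ∑ i, gradient (fi i) xbar j - ∑ i, gradient (fi i) xstar j := by
            rw [h1, h2]; field_simp
          rw [← h3, h0]; ring
        · intro i _ hne
          by_contra h
          have := hA xbar i j
          rw [hzero i h] at this
          apply hne
          have h4 : A xbar i j ^ 2 = 0 := le_antisymm (by linarith) (sq_nonneg _)
          exact pow_eq_zero_iff (two_ne_zero) |>.1 h4)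
    rw [e]
    have := mul_le_mul_of_nonneg_left hs (show 0 ≤ S / v j by positivity)
    refine this.trans (le_of_eq ?_)
    ring
  refine (Finset.sum_le_sum fun j _ => hterm j).trans ?_
  rw [Finset.sum_add_distrib, ← Finset.mul_sum, ← Finset.mul_sum]
  have := hB y
  have := hB xbar
  linarith
end

section
/- Suppose in addition that f is μ-strongly convex with μ > 0 and attains its minimum at x* ∈ ℝ^d, and suppose v_j > 0 for all j ∈ {1,…,d}. Fix points y, x̄ ∈ ℝ^d and for each pair (i,j) with L_{ij} > 0 define G^{ij} := ∇_j f(x̄) + (1/(n q_{ij})) ( ∇_j f_i(y) − ∇_j f_i(x̄) ) and g^{ij} := p_j^{-1} G^{ij} e_j ∈ ℝ^d. Then: Σ_{j=1}^d Σ_{i : L_{ij} > 0} p_j q_{ij} ‖g^{ij}‖² ≤ 4 L̂ ( f(y) − f(x*) ) + 4 ( L̂ − μ / max_{1≤s≤d} p_s ) ( f(x̄) − f(x*) ), where L̂ := (1/n) Σ_{j=1}^d v_j. -/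
open RealInnerProductSpace


lemma aux_grad_ineq {d : ℕ} (φ : EuclideanSpace ℝ (Fin d) → ℝ) (hd : Differentiable ℝ φ)
    (hc : ConvexOn ℝ Set.univ φ) (x z : EuclideanSpace ℝ (Fin d)) :
    φ x + ⟪gradient φ x, z - x⟫ ≤ φ z := by
  have h1 : HasDerivAt (fun t : ℝ => φ (AffineMap.lineMap x z t)) ⟪gradient φ x, z - x⟫ 0 := by
    have h2 : HasFDerivAt φ (fderiv ℝ φ x) (AffineMap.lineMap x z (0:ℝ)) := by
      simpa using (hd x).hasFDerivAt
    have h3 := h2.comp_hasDerivAt (0:ℝ) (AffineMap.hasDerivAt_lineMap (a := x) (b := z))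
    have h4 : ⟪gradient φ x, z - x⟫ = fderiv ℝ φ x (z - x) := by
      simp [gradient]
    rw [h4]
    exact h3
  have hc' : ConvexOn ℝ Set.univ (fun t : ℝ => φ (AffineMap.lineMap x z t)) := by
    have := hc.comp_affineMap (AffineMap.lineMap (k := ℝ) x z)
    rw [Set.preimage_univ] at this
    exact this
  have h5 := hc'.le_slope_of_hasDerivAt (Set.mem_univ 0) (Set.mem_univ 1) zero_lt_one h1
  rw [slope_def_field] at h5
  simp only [AffineMap.lineMap_apply_one, AffineMap.lineMap_apply_zero, sub_zero, div_one] at h5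
  linarith

lemma aux_key {d : ℕ} (φ : EuclideanSpace ℝ (Fin d) → ℝ) (hd : Differentiable ℝ φ)
    (hc : ConvexOn ℝ Set.univ φ) (l : ℝ) (j : Fin d)
    (hs : ∀ (x : EuclideanSpace ℝ (Fin d)) (h : ℝ),
      φ (x + h • EuclideanSpace.single j 1) ≤
        φ x + ⟪gradient φ x, h • EuclideanSpace.single j 1⟫ + l / 2 * h ^ 2)
    (x y : EuclideanSpace ℝ (Fin d)) (h : ℝ) :
    0 ≤ (φ y - φ x - ⟪gradient φ x, y - x⟫) + h * (gradient φ y j - gradient φ x j)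
      + l / 2 * h ^ 2 := by
  have h1 := hs y h
  have h2 := aux_grad_ineq φ hd hc x (y + h • EuclideanSpace.single j 1)
  have e : y + h • EuclideanSpace.single j (1:ℝ) - x
      = (y - x) + h • EuclideanSpace.single j (1:ℝ) := by abel
  rw [e, inner_add_right] at h2
  simp only [inner_smul_right, EuclideanSpace.inner_single_right] at h1 h2
  simp only [conj_trivial, one_mul] at h1 h2
  linarith

lemma aux_pos {D a l : ℝ} (hl : 0 < l) (h : ∀ t : ℝ, 0 ≤ D + t * a + l / 2 * t ^ 2) :
    a ^ 2 / l ≤ 2 * D := by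
  have := h (-(a / l))
  have e : D + -(a / l) * a + l / 2 * (-(a / l)) ^ 2 = D - a ^ 2 / l / 2 := by
    field_simp
    ring
  rw [e] at this
  linarith

lemma aux_zero {D a : ℝ} (h : ∀ t : ℝ, 0 ≤ D + t * a) : a = 0 := by
  by_contra ha
  have := h (-(D + 1) / a)
  rw [div_mul_cancel₀ _ ha] at this
  linarith

/-- The strengthened variance bound of Section 4 of the paper:
`Σ_j Σ_{i : L_{ij} > 0} p_j q_{ij} ‖g^{ij}‖²
  ≤ 4 L̂ (f y − f x*) + 4 (L̂ − μ / max_s p_s) (f x̄ − f x*)`. -/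
theorem stmt6 {n d : ℕ} (hn : 0 < n) (hd : 0 < d)
    (fi : Fin n → EuclideanSpace ℝ (Fin d) → ℝ)
    (hdiff : ∀ i, Differentiable ℝ (fi i))
    (hconv : ∀ i, ConvexOn ℝ Set.univ (fi i))
    (L : Fin n → Fin d → ℝ) (hL : ∀ i j, 0 ≤ L i j)
    (hsmooth : ∀ (i : Fin n) (j : Fin d) (x : EuclideanSpace ℝ (Fin d)) (h : ℝ),
      fi i (x + h • EuclideanSpace.single j 1) ≤
        fi i x + ⟪gradient (fi i) x, h • EuclideanSpace.single j 1⟫ + L i j / 2 * h ^ 2)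
    (f : EuclideanSpace ℝ (Fin d) → ℝ)
    (hf : ∀ x, f x = (1 / n : ℝ) * ∑ i, fi i x)
    (μ : ℝ) (hμ : 0 < μ)
    (hsc : ∀ x z : EuclideanSpace ℝ (Fin d),
      f x + ⟪gradient f x, z - x⟫ + μ / 2 * ‖z - x‖ ^ 2 ≤ f z)
    (xstar : EuclideanSpace ℝ (Fin d)) (hmin : ∀ x, f xstar ≤ f x)
    (ω : Fin n → ℝ)
    (hω : ∀ i, ω i = ((Finset.univ.filter fun j => L i j ≠ 0).card : ℝ))
    (v : Fin d → ℝ) (hv : ∀ j, v j = ∑ i, ω i * L i j)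
    (hvpos : ∀ j, 0 < v j)
    (p : Fin d → ℝ) (hp : ∀ j, p j = v j / ∑ s, v s)
    (q : Fin n → Fin d → ℝ)
    (hq : ∀ i j, 0 < L i j → q i j = ω i * L i j / v j)
    (Lhat : ℝ) (hLhat : Lhat = (1 / n : ℝ) * ∑ j, v j)
    (y xbar : EuclideanSpace ℝ (Fin d))
    (G : Fin n → Fin d → ℝ)
    (hG : ∀ i j, 0 < L i j → G i j = gradient f xbar j +
      (1 / (n * q i j)) * (gradient (fi i) y j - gradient (fi i) xbar j))
    (g : Fin n → Fin d → EuclideanSpace ℝ (Fin d))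
    (hg : ∀ i j, 0 < L i j →
      g i j = ((p j)⁻¹ * G i j) • (EuclideanSpace.single j 1 : EuclideanSpace ℝ (Fin d))) :
    ∑ j, ∑ i ∈ Finset.univ.filter (fun i => 0 < L i j), p j * q i j * ‖g i j‖ ^ 2
      ≤ 4 * Lhat * (f y - f xstar)
        + 4 * (Lhat - μ / (⨆ s, p s)) * (f xbar - f xstar) := by
  classical
  have hn' : (0:ℝ) < n := by exact_mod_cast hn
  have : Nonempty (Fin d) := ⟨⟨0, hd⟩⟩
  have hS : 0 < ∑ s, v s := Finset.sum_pos (fun j _ => hvpos j) Finset.univ_nonempty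
  have hppos : ∀ j, 0 < p j := fun j => by rw [hp]; exact div_pos (hvpos j) hS
  have hLh : 0 < Lhat := by rw [hLhat]; positivity
  -- gradient of the average
  have hfe : f = fun x => (1 / n : ℝ) * ∑ i, fi i x := funext hf
  have hgrad : ∀ x, HasGradientAt f ((1 / n : ℝ) • ∑ i, gradient (fi i) x) x := by
    intro x
    rw [hasGradientAt_iff_hasFDerivAt, hfe]
    have h1 : HasFDerivAt (fun x => ∑ i, fi i x) (∑ i, fderiv ℝ (fi i) x) x :=
      HasFDerivAt.fun_sum fun i _ => (hdiff i x).hasFDerivAt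
    have h2 := h1.const_mul (1 / n : ℝ)
    have e : (InnerProductSpace.toDual ℝ (EuclideanSpace ℝ (Fin d)))
        ((1 / n : ℝ) • ∑ i, gradient (fi i) x) = (1 / n : ℝ) • ∑ i, fderiv ℝ (fi i) x := by
      rw [map_smul, map_sum]
      simp only [toDual_gradient]
    rw [e]
    exact h2
  have hgf : ∀ x, gradient f x = (1 / n : ℝ) • ∑ i, gradient (fi i) x := fun x => (hgrad x).gradient
  have hgfj : ∀ x j, gradient f x j = (1 / n : ℝ) * ∑ i, gradient (fi i) x j := by
    intro x j
    rw [hgf]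
    simp
  have hstar : gradient f xstar = 0 := by
    have : IsLocalMin f xstar := Filter.Eventually.of_forall hmin
    have h0 := this.fderiv_eq_zero
    simp [gradient, h0]
  have hkey := fun i j x z => aux_key (fi i) (hdiff i) (hconv i) (L i j) j (hsmooth i j) x z
  set D : Fin n → EuclideanSpace ℝ (Fin d) → ℝ := fun i z =>
    fi i z - fi i xstar - ⟪gradient (fi i) xstar, z - xstar⟫ with hD
  set a : EuclideanSpace ℝ (Fin d) → Fin n → Fin d → ℝ := fun z i j =>
    gradient (fi i) z j - gradient (fi i) xstar j with ha
  have hpos : ∀ z i j, 0 < L i j → a z i j ^ 2 / L i j ≤ 2 * D i z := fun z i j hl =>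
    aux_pos hl (hkey i j xstar z)
  have hzero : ∀ z i j, ¬ 0 < L i j → a z i j = 0 := by
    intro z i j hl
    have hl0 : L i j = 0 := le_antisymm (not_lt.mp hl) (hL i j)
    refine aux_zero (D := D i z) fun t => ?_
    have := hkey i j xstar z t
    rw [hl0] at this
    simpa [hD, ha] using this
  have hsumD : ∀ z, ∑ i, D i z = n * (f z - f xstar) := by
    intro z
    have h1 : ∑ i, ⟪gradient (fi i) xstar, z - xstar⟫ = 0 := by
      rw [← sum_inner]
      have h2 := hgf xstar
      rw [hstar] at h2
      have h3 : ∑ i, gradient (fi i) xstar = 0 := by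
        rcases smul_eq_zero.mp h2.symm with h | h
        · exfalso
          have : (0:ℝ) < 1 / n := by positivity
          linarith
        · exact h
      rw [h3, inner_zero_left]
    simp only [hD, Finset.sum_sub_distrib, h1, hf]
    field_simp
    ring
  have hωpos : ∀ i j, 0 < L i j → 0 < ω i := by
    intro i j hl
    rw [hω]
    exact_mod_cast Finset.card_pos.mpr ⟨j, by simp [hl.ne']⟩
  have hqpos : ∀ i j, 0 < L i j → 0 < q i j := by
    intro i j hl
    rw [hq i j hl]
    exact div_pos (mul_pos (hωpos i j hl) hl) (hvpos j)
  -- sums over support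
  have hqsum : ∀ j, ∑ i ∈ Finset.univ.filter (fun i => 0 < L i j), q i j = 1 := by
    intro j
    have h1 : ∑ i ∈ Finset.univ.filter (fun i => 0 < L i j), q i j
        = ∑ i ∈ Finset.univ.filter (fun i => 0 < L i j), ω i * L i j / v j :=
      Finset.sum_congr rfl fun i hi => hq i j (Finset.mem_filter.mp hi).2
    have h2 : ∑ i ∈ Finset.univ.filter (fun i => 0 < L i j), ω i * L i j / v j
        = ∑ i, ω i * L i j / v j := by
      apply Finset.sum_subset (Finset.filter_subset _ _)
      intro i _ hi
      have hl : ¬ 0 < L i j := fun h => hi (by simp [h])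
      have hl0 : L i j = 0 := le_antisymm (not_lt.mp hl) (hL i j)
      simp [hl0]
    rw [h1, h2, ← Finset.sum_div, ← hv, div_self (hvpos j).ne']
  have hbsum : ∀ j, ∑ i ∈ Finset.univ.filter (fun i => 0 < L i j), a xbar i j
      = n * gradient f xbar j := by
    intro j
    have h2 : ∑ i ∈ Finset.univ.filter (fun i => 0 < L i j), a xbar i j
        = ∑ i, a xbar i j := by
      apply Finset.sum_subset (Finset.filter_subset _ _)
      intro i _ hi
      exact hzero _ _ _ fun h => hi (by simp [h])
    have h3 := hgfj xstar j
    rw [hstar] at h3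
    have h4 : ∑ i, gradient (fi i) xstar j = 0 := by
      have : (1 / n : ℝ) ≠ 0 := by positivity
      simpa [this, hn'.ne'] using h3.symm
    rw [h2]
    simp only [ha, Finset.sum_sub_distrib]
    rw [h4, hgfj]
    field_simp
    simp
  -- main bound on weighted squares
  have hW : ∀ z, ∑ j, ∑ i ∈ Finset.univ.filter (fun i => 0 < L i j),
      (p j)⁻¹ * (a z i j ^ 2 / (n ^ 2 * q i j)) ≤ 2 * Lhat * (f z - f xstar) := by
    intro z
    have h1 : ∀ i, ∑ j ∈ Finset.univ.filter (fun j => 0 < L i j),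
        (p j)⁻¹ * (a z i j ^ 2 / (n ^ 2 * q i j)) ≤ Lhat / n * (2 * D i z) := by
      intro i
      have hDi : 0 ≤ D i z := by
        have := aux_grad_ineq (fi i) (hdiff i) (hconv i) xstar z
        simp only [hD]
        linarith
      by_cases he : ∃ j, 0 < L i j
      · obtain ⟨j0, hj0⟩ := he
        have hωi := hωpos i j0 hj0
        have hcard : ((Finset.univ.filter (fun j => 0 < L i j)).card : ℝ) = ω i := by
          rw [hω]
          congr 2
          ext j
          simp [(hL i j).lt_iff_ne, eq_comm]
        calc _ ≤ ∑ j ∈ Finset.univ.filter (fun j => 0 < L i j),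
              Lhat / n / ω i * (2 * D i z) := by
              apply Finset.sum_le_sum
              intro j hj
              have hl := (Finset.mem_filter.mp hj).2
              have e : (p j)⁻¹ * (a z i j ^ 2 / (n ^ 2 * q i j))
                  = Lhat / n / ω i * (a z i j ^ 2 / L i j) := by
                have := (hvpos j).ne'
                rw [hp, hq i j hl, hLhat]
                field_simp
              rw [e]
              exact mul_le_mul_of_nonneg_left (hpos z i j hl) (by positivity)
          _ = _ := by
              rw [Finset.sum_const, nsmul_eq_mul, hcard]
              field_simp
      · have : Finset.univ.filter (fun j => 0 < L i j) = ∅ := by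
          ext j
          simpa using not_lt.mp fun h => he ⟨j, h⟩
        rw [this, Finset.sum_empty]
        positivity
    calc _ = ∑ i, ∑ j ∈ Finset.univ.filter (fun j => 0 < L i j),
          (p j)⁻¹ * (a z i j ^ 2 / (n ^ 2 * q i j)) := by
          simp only [Finset.sum_filter]
          exact Finset.sum_comm
      _ ≤ ∑ i, Lhat / n * (2 * D i z) := Finset.sum_le_sum fun i _ => h1 i
      _ = _ := by
          rw [← Finset.mul_sum, ← Finset.mul_sum, hsumD]
          field_simp
  -- per-coordinate bound
  have hC : ∀ j, ∑ i ∈ Finset.univ.filter (fun i => 0 < L i j), p j * q i j * ‖g i j‖ ^ 2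
      ≤ 2 * ∑ i ∈ Finset.univ.filter (fun i => 0 < L i j),
          (p j)⁻¹ * (a y i j ^ 2 / (n ^ 2 * q i j))
        + 2 * ∑ i ∈ Finset.univ.filter (fun i => 0 < L i j),
          (p j)⁻¹ * (a xbar i j ^ 2 / (n ^ 2 * q i j))
        - 2 * ((p j)⁻¹ * gradient f xbar j ^ 2) := by
    intro j
    set c := gradient f xbar j with hc
    have hpj := hppos j
    calc _ ≤ ∑ i ∈ Finset.univ.filter (fun i => 0 < L i j),
          (2 * ((p j)⁻¹ * (a y i j ^ 2 / (n ^ 2 * q i j)))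
            + 2 * ((p j)⁻¹ * (a xbar i j ^ 2 / (n ^ 2 * q i j)))
            + 2 * (p j)⁻¹ * c ^ 2 * q i j - 4 * (p j)⁻¹ * c / n * a xbar i j) := by
          apply Finset.sum_le_sum
          intro i hi
          have hl := (Finset.mem_filter.mp hi).2
          have hqi := hqpos i j hl
          have hn2 : ‖g i j‖ ^ 2 = ((p j)⁻¹ * G i j) ^ 2 := by
            rw [hg i j hl, norm_smul]
            simp [mul_pow]
          have hGa : G i j = c + (1 / (n * q i j)) * (a y i j - a xbar i j) := by
            rw [hG i j hl]
            simp only [ha, hc]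
            ring
          rw [hn2, hGa]
          have e : (2 * ((p j)⁻¹ * (a y i j ^ 2 / (n ^ 2 * q i j)))
            + 2 * ((p j)⁻¹ * (a xbar i j ^ 2 / (n ^ 2 * q i j)))
            + 2 * (p j)⁻¹ * c ^ 2 * q i j - 4 * (p j)⁻¹ * c / n * a xbar i j)
            - p j * q i j * ((p j)⁻¹ * (c + (1 / (n * q i j)) * (a y i j - a xbar i j))) ^ 2
            = (p j)⁻¹ * q i j * (a y i j / (n * q i j) - (c - a xbar i j / (n * q i j))) ^ 2 := by
            field_simp
            ring
          have : 0 ≤ (p j)⁻¹ * q i j *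
            (a y i j / (n * q i j) - (c - a xbar i j / (n * q i j))) ^ 2 := by positivity
          linarith
      _ = _ := by
          rw [Finset.sum_sub_distrib, Finset.sum_add_distrib, Finset.sum_add_distrib,
            ← Finset.mul_sum _ (fun i => (p j)⁻¹ * (a y i j ^ 2 / (n ^ 2 * q i j))),
            ← Finset.mul_sum _ (fun i => (p j)⁻¹ * (a xbar i j ^ 2 / (n ^ 2 * q i j))),
            ← Finset.mul_sum _ (fun i => q i j), ← Finset.mul_sum _ (fun i => a xbar i j),
            hqsum, hbsum, ← hc]
          have e : 4 * (p j)⁻¹ * c / n * (n * c) = 4 * ((p j)⁻¹ * c ^ 2) := by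
            field_simp
          rw [e]
          ring
  -- strong convexity
  have hPL : 2 * μ * (f xbar - f xstar) ≤ ‖gradient f xbar‖ ^ 2 := by
    have h1 := hsc xbar xstar
    have h2 := norm_add_sq_real (gradient f xbar) (μ • (xstar - xbar))
    rw [inner_smul_right, norm_smul, mul_pow, Real.norm_eq_abs, sq_abs] at h2
    have h3 := sq_nonneg ‖gradient f xbar + μ • (xstar - xbar)‖
    nlinarith
  have hM : ∀ j, p j ≤ ⨆ s, p s := fun j => le_ciSup (Set.finite_range p).bddAbove j
  have hMpos : 0 < ⨆ s, p s := (hppos ⟨0, hd⟩).trans_le (hM _)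
  have hlast : 2 * (μ / (⨆ s, p s)) * (f xbar - f xstar)
      ≤ ∑ j, (p j)⁻¹ * gradient f xbar j ^ 2 := by
    calc _ = (⨆ s, p s)⁻¹ * (2 * μ * (f xbar - f xstar)) := by field_simp
      _ ≤ (⨆ s, p s)⁻¹ * ‖gradient f xbar‖ ^ 2 :=
          mul_le_mul_of_nonneg_left hPL (by positivity)
      _ = ∑ j, (⨆ s, p s)⁻¹ * gradient f xbar j ^ 2 := by
          rw [EuclideanSpace.norm_sq_eq, Finset.mul_sum]
          simp
      _ ≤ _ := by
          apply Finset.sum_le_sum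
          intro j _
          exact mul_le_mul_of_nonneg_right (inv_anti₀ (hppos j) (hM j)) (sq_nonneg _)
  have hfin := Finset.sum_le_sum fun j (_ : j ∈ Finset.univ) => hC j
  rw [Finset.sum_sub_distrib, Finset.sum_add_distrib, ← Finset.mul_sum, ← Finset.mul_sum,
    ← Finset.mul_sum] at hfin
  have hy := hW y
  have hx := hW xbar
  linarith
end

section
/- Suppose f attains its minimum at x* ∈ ℝ^d, and suppose v_j > 0 for all j ∈ {1,…,d}. Then for every y ∈ ℝ^d: 2 Σ_{s=1}^d p_s^{-1} Σ_{i : L_{is} > 0} q_{is} ( (∇_s f_i(y) − ∇_s f_i(x*)) / (n q_{is}) )² ≤ 4 L̂ ( f(y) − f(x*) ), where L̂ := (1/n) Σ_{j=1}^d v_j. -/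
open RealInnerProductSpace

theorem aux_convex {d : ℕ} (g : EuclideanSpace ℝ (Fin d) → ℝ) (hd : Differentiable ℝ g)
    (hc : ConvexOn ℝ Set.univ g) (x z : EuclideanSpace ℝ (Fin d)) :
    g x + ⟪gradient g x, z - x⟫ ≤ g z := by
  have h1 : ConvexOn ℝ Set.univ (fun t : ℝ => g (AffineMap.lineMap x z t)) := by
    have := hc.comp_affineMap (AffineMap.lineMap (k := ℝ) x z)
    simpa [Function.comp_def] using this
  have hg : HasFDerivAt g (fderiv ℝ g x) (AffineMap.lineMap (k := ℝ) x z 0) := by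
    simpa using (hd x).hasFDerivAt
  have h2 : HasDerivAt (fun t : ℝ => g (AffineMap.lineMap x z t)) (fderiv ℝ g x (z - x)) 0 :=
    hg.comp_hasDerivAt (0:ℝ) (AffineMap.hasDerivAt_lineMap)
  have h3 := h1.le_slope_of_hasDerivAt (Set.mem_univ 0) (Set.mem_univ 1) one_pos h2
  have h4 : ⟪gradient g x, z - x⟫ = fderiv ℝ g x (z - x) := by
    simp [gradient]
  rw [h4]
  simp [slope_def_field] at h3
  rw [map_sub]
  linarith

theorem aux_coord {d : ℕ} (g : EuclideanSpace ℝ (Fin d) → ℝ) (hd : Differentiable ℝ g)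
    (hc : ConvexOn ℝ Set.univ g) (l : ℝ) (hl : 0 < l) (j : Fin d)
    (y x : EuclideanSpace ℝ (Fin d))
    (hs : ∀ h : ℝ, g (y + h • EuclideanSpace.single j 1) ≤
        g y + ⟪gradient g y, h • EuclideanSpace.single j 1⟫ + l / 2 * h ^ 2) :
    (gradient g y j - gradient g x j) ^ 2 / l ≤ 2 * (g y - g x - ⟪gradient g x, y - x⟫) := by
  set D := gradient g y j - gradient g x j with hD
  have h1 := hs (-(D / l))
  have h2 := aux_convex g hd hc x (y + (-(D / l)) • EuclideanSpace.single j 1)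
  rw [add_sub_right_comm, inner_add_right] at h2
  rw [inner_smul_right] at h1 h2
  have e : ∀ u : EuclideanSpace ℝ (Fin d), ⟪u, EuclideanSpace.single j (1:ℝ)⟫ = u j := by
    intro u; simp [EuclideanSpace.inner_single_right]
  rw [e] at h1 h2
  have h3 : l / 2 * (-(D / l)) ^ 2 = D ^ 2 / l / 2 := by field_simp
  have h4 : (D / l) * gradient g y j - (D / l) * gradient g x j = D ^ 2 / l := by
    rw [← mul_sub, ← hD]; ring
  linarith

theorem aux_sum_s7 {d : ℕ} (g : EuclideanSpace ℝ (Fin d) → ℝ) (hd : Differentiable ℝ g)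
    (hc : ConvexOn ℝ Set.univ g) (l : Fin d → ℝ) (hl : ∀ j, 0 ≤ l j)
    (y x : EuclideanSpace ℝ (Fin d)) (w : ℝ)
    (hw : w = ((Finset.univ.filter fun j => l j ≠ 0).card : ℝ))
    (hs : ∀ j, ∀ h : ℝ, g (y + h • EuclideanSpace.single j 1) ≤
        g y + ⟪gradient g y, h • EuclideanSpace.single j 1⟫ + l j / 2 * h ^ 2) :
    ∑ j ∈ Finset.univ.filter (fun j => 0 < l j),
      (gradient g y j - gradient g x j) ^ 2 / (w * l j)
      ≤ 2 * (g y - g x - ⟪gradient g x, y - x⟫) := by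
  have h0 := aux_convex g hd hc x y
  have hF : (Finset.univ.filter fun j => l j ≠ 0) = Finset.univ.filter (fun j => 0 < l j) := by
    ext j; simp [(hl j).lt_iff_ne']
  rw [hF] at hw
  set S := Finset.univ.filter (fun j => 0 < l j) with hS
  set B := 2 * (g y - g x - ⟪gradient g x, y - x⟫) with hB
  have hB0 : 0 ≤ B := by linarith
  have hw0 : 0 ≤ w := by rw [hw]; positivity
  calc _ ≤ ∑ j ∈ S, B / w := by
        apply Finset.sum_le_sum
        intro j hj
        have hj' : 0 < l j := by simpa [hS] using hj
        have := aux_coord g hd hc (l j) hj' j y x (hs j)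
        rw [mul_comm, ← div_div]
        gcongr
    _ = w * (B / w) := by rw [Finset.sum_const, nsmul_eq_mul, ← hw]
    _ ≤ B := by
        rcases eq_or_ne w 0 with h | h
        · simp [h, hB0]
        · rw [mul_div_cancel₀ _ h]

/-- Step 3 of the proof of the variance lemma:
`2 Σ_s p_s⁻¹ Σ_{i : L_{is} > 0} q_{is} ((∇_s f_i(y) − ∇_s f_i(x*)) / (n q_{is}))²
  ≤ 4 L̂ (f y − f x*)`. -/
theorem stmt7 {n d : ℕ} (hn : 0 < n)
    (fi : Fin n → EuclideanSpace ℝ (Fin d) → ℝ)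
    (hdiff : ∀ i, Differentiable ℝ (fi i))
    (hconv : ∀ i, ConvexOn ℝ Set.univ (fi i))
    (L : Fin n → Fin d → ℝ) (hL : ∀ i j, 0 ≤ L i j)
    (hsmooth : ∀ (i : Fin n) (j : Fin d) (x : EuclideanSpace ℝ (Fin d)) (h : ℝ),
      fi i (x + h • EuclideanSpace.single j 1) ≤
        fi i x + ⟪gradient (fi i) x, h • EuclideanSpace.single j 1⟫ + L i j / 2 * h ^ 2)
    (f : EuclideanSpace ℝ (Fin d) → ℝ)
    (hf : ∀ x, f x = (1 / n : ℝ) * ∑ i, fi i x)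
    (xstar : EuclideanSpace ℝ (Fin d)) (hmin : ∀ x, f xstar ≤ f x)
    (ω : Fin n → ℝ)
    (hω : ∀ i, ω i = ((Finset.univ.filter fun j => L i j ≠ 0).card : ℝ))
    (v : Fin d → ℝ) (hv : ∀ j, v j = ∑ i, ω i * L i j)
    (hvpos : ∀ j, 0 < v j)
    (p : Fin d → ℝ) (hp : ∀ j, p j = v j / ∑ s, v s)
    (q : Fin n → Fin d → ℝ)
    (hq : ∀ i j, 0 < L i j → q i j = ω i * L i j / v j)
    (Lhat : ℝ) (hLhat : Lhat = (1 / n : ℝ) * ∑ j, v j)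
    (y : EuclideanSpace ℝ (Fin d)) :
    2 * ∑ s, (p s)⁻¹ * ∑ i ∈ Finset.univ.filter (fun i => 0 < L i s),
        q i s * ((gradient (fi i) y s - gradient (fi i) xstar s) / (n * q i s)) ^ 2
      ≤ 4 * Lhat * (f y - f xstar) := by
  have hn' : (0:ℝ) < n := by exact_mod_cast hn
  have hω0 : ∀ i, 0 ≤ ω i := fun i => by rw [hω]; positivity
  have hV0 : 0 ≤ ∑ s, v s := Finset.sum_nonneg fun s _ => (hvpos s).le
  have hgrad : ∑ i, ⟪gradient (fi i) xstar, y - xstar⟫ = 0 := by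
    have hfd : HasFDerivAt f ((1 / n : ℝ) • ∑ i, fderiv ℝ (fi i) xstar) xstar := by
      have e : f = fun x => (1 / n : ℝ) * ∑ i, fi i x := funext hf
      rw [e]
      exact (HasFDerivAt.fun_sum fun i _ => (hdiff i xstar).hasFDerivAt).const_mul _
    have hz := IsLocalMin.hasFDerivAt_eq_zero (Filter.Eventually.of_forall hmin) hfd
    have hz2 := congrArg (fun T => T (y - xstar)) hz
    have hz3 : ∑ i, fderiv ℝ (fi i) xstar (y - xstar) = 0 := by
      simpa [hn.ne'] using hz2
    rw [← hz3]
    exact Finset.sum_congr rfl fun i _ => by simp [gradient]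
  have hterm : ∀ s, (p s)⁻¹ * ∑ i ∈ Finset.univ.filter (fun i => 0 < L i s),
        q i s * ((gradient (fi i) y s - gradient (fi i) xstar s) / (n * q i s)) ^ 2
      = ((∑ s, v s) / n ^ 2) * ∑ i ∈ Finset.univ.filter (fun i => 0 < L i s),
        (gradient (fi i) y s - gradient (fi i) xstar s) ^ 2 / (ω i * L i s) := by
    intro s
    rw [Finset.mul_sum, Finset.mul_sum]
    refine Finset.sum_congr rfl fun i hi => ?_
    have hi' : 0 < L i s := by simpa using hi
    have hwi : 0 < ω i := by
      rw [hω]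
      exact_mod_cast Finset.card_pos.mpr ⟨s, by simp [hi'.ne']⟩
    have hv' := hvpos s
    rw [hp, hq i s hi', inv_div]
    field_simp
  rw [Finset.sum_congr rfl fun s _ => hterm s, ← Finset.mul_sum]
  have hswap : ∑ s, ∑ i ∈ Finset.univ.filter (fun i => 0 < L i s),
        (gradient (fi i) y s - gradient (fi i) xstar s) ^ 2 / (ω i * L i s)
      = ∑ i, ∑ s ∈ Finset.univ.filter (fun s => 0 < L i s),
        (gradient (fi i) y s - gradient (fi i) xstar s) ^ 2 / (ω i * L i s) := by
    simp only [Finset.sum_filter]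
    exact Finset.sum_comm
  rw [hswap]
  have hb : ∑ i, ∑ s ∈ Finset.univ.filter (fun s => 0 < L i s),
        (gradient (fi i) y s - gradient (fi i) xstar s) ^ 2 / (ω i * L i s)
      ≤ 2 * (n * (f y - f xstar)) := by
    calc _ ≤ ∑ i, 2 * (fi i y - fi i xstar - ⟪gradient (fi i) xstar, y - xstar⟫) :=
          Finset.sum_le_sum fun i _ => aux_sum_s7 (fi i) (hdiff i) (hconv i) (L i) (hL i) y xstar
            (ω i) (hω i) (fun j h => hsmooth i j y h)
      _ = _ := by
          rw [← Finset.mul_sum, Finset.sum_sub_distrib, Finset.sum_sub_distrib, hgrad, hf, hf]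
          field_simp
          ring
  calc _ ≤ 2 * ((∑ s, v s) / n ^ 2 * (2 * (n * (f y - f xstar)))) := by gcongr
    _ = _ := by
        rw [hLhat]
        field_simp
        try ring
end

section
/- Let m ≥ 1 be an integer and let μ > 0, L̂ > 0, and h satisfy 0 < h < 1/(2L̂) and μ h < 1. Let η_0, …, η_m ≥ 0 and ξ_0, …, ξ_{m−1} ≥ 0 be nonnegative real numbers satisfying η_{t+1} + h(1 − 2hL̂) ξ_t ≤ (1 − μh) η_t + 2h²L̂ ξ_0 for all t ∈ {0, …, m−1}, together with ξ_0 ≥ μ η_0. Define β := Σ_{t=0}^{m−1} (1 − μh)^t. Then the weighted average of the ξ_t contracts: (1/β) Σ_{t=0}^{m−1} (1 − μh)^{m−1−t} ξ_t ≤ ( (1 − μh)^m / ( (1 − (1 − μh)^m)(1 − 2L̂h) ) + 2L̂h / (1 − 2L̂h) ) ξ_0. -/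
theorem stmt11_aux (m : ℕ) (q a b : ℝ) (hq : 0 < q) (η ξ : ℕ → ℝ)
    (hrec : ∀ t < m, η (t + 1) + a * ξ t ≤ q * η t + b) :
    ∀ k ≤ m, η k + a * ∑ t ∈ Finset.range k, q ^ (k - 1 - t) * ξ t
      ≤ q ^ k * η 0 + b * ∑ t ∈ Finset.range k, q ^ t := by
  intro k
  induction k with
  | zero => intro _; simp
  | succ k ih =>
    intro hk
    have h1 := ih (by omega)
    have h2 := hrec k (by omega)
    have e1 : ∑ t ∈ Finset.range (k + 1), q ^ (k + 1 - 1 - t) * ξ t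
        = q * (∑ t ∈ Finset.range k, q ^ (k - 1 - t) * ξ t) + ξ k := by
      rw [Finset.sum_range_succ, Finset.mul_sum]
      congr 1
      · apply Finset.sum_congr rfl
        intro t ht
        have := Finset.mem_range.mp ht
        rw [show k + 1 - 1 - t = (k - 1 - t) + 1 by omega, pow_succ]
        ring
      · simp
    have e2 : ∑ t ∈ Finset.range (k + 1), q ^ t
        = q * (∑ t ∈ Finset.range k, q ^ t) + 1 := by
      rw [Finset.sum_range_succ', Finset.mul_sum]
      simp [pow_succ, mul_comm]
    rw [e1, e2, pow_succ]
    have h3 := mul_le_mul_of_nonneg_left h1 hq.le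
    linarith

/-- The deterministic core of Theorem 2 of the paper: under the one-step recursion and
`ξ 0 ≥ μ η 0`, the `(1 − μh)^{m−1−t}`-weighted average of the `ξ t` contracts by the factor
`(1 − μh)^m / ((1 − (1 − μh)^m)(1 − 2L̂h)) + 2L̂h / (1 − 2L̂h)`. -/
theorem stmt11 (m : ℕ) (hm : 1 ≤ m) (μ Lhat h : ℝ)
    (hμ : 0 < μ) (hL : 0 < Lhat) (hh : 0 < h) (hh2 : h < 1 / (2 * Lhat))
    (hμh : μ * h < 1)
    (η ξ : ℕ → ℝ)
    (hη : ∀ t ≤ m, 0 ≤ η t) (hξ : ∀ t < m, 0 ≤ ξ t)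
    (hrec : ∀ t < m, η (t + 1) + h * (1 - 2 * h * Lhat) * ξ t
      ≤ (1 - μ * h) * η t + 2 * h ^ 2 * Lhat * ξ 0)
    (hξ0 : μ * η 0 ≤ ξ 0) :
    (1 / ∑ t ∈ Finset.range m, (1 - μ * h) ^ t) *
        ∑ t ∈ Finset.range m, (1 - μ * h) ^ (m - 1 - t) * ξ t
      ≤ ((1 - μ * h) ^ m / ((1 - (1 - μ * h) ^ m) * (1 - 2 * Lhat * h))
          + 2 * Lhat * h / (1 - 2 * Lhat * h)) * ξ 0 := by
  have hq : 0 < 1 - μ * h := by linarith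
  have hc : 0 < 1 - 2 * Lhat * h := by
    rw [lt_div_iff₀ (by positivity)] at hh2
    linarith
  have key := stmt11_aux m (1 - μ * h) _ _ hq η ξ hrec m le_rfl
  have hB : 0 < ∑ t ∈ Finset.range m, (1 - μ * h) ^ t :=
    Finset.sum_pos (fun t _ => pow_pos hq t) (Finset.nonempty_range_iff.mpr (by omega))
  have hg := mul_neg_geom_sum (1 - μ * h) m
  have hηm := hη m le_rfl
  have hP : 0 < (1 - μ * h) ^ m := pow_pos hq m
  rw [← hg]
  generalize (∑ t ∈ Finset.range m, (1 - μ * h) ^ t) = B at *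
  generalize (∑ t ∈ Finset.range m, (1 - μ * h) ^ (m - 1 - t) * ξ t) = S at *
  generalize (1 - μ * h) ^ m = P at *
  have hP2 := mul_le_mul_of_nonneg_left hξ0 hP.le
  have k2 : μ * (h * (1 - 2 * h * Lhat) * S)
      ≤ P * ξ 0 + μ * (2 * h ^ 2 * Lhat * ξ 0 * B) := by
    have := mul_le_mul_of_nonneg_left key hμ.le
    have := mul_nonneg hμ.le hηm
    linarith
  have e : (P / ((1 - (1 - μ * h)) * B * (1 - 2 * Lhat * h))
      + 2 * Lhat * h / (1 - 2 * Lhat * h)) * ξ 0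
      = (P * ξ 0 + μ * (2 * h ^ 2 * Lhat * ξ 0 * B)) / (μ * h * B * (1 - 2 * Lhat * h)) := by
    rw [sub_sub_cancel]
    have := hc.ne'
    field_simp
  have e' : 1 / B * S = μ * (h * (1 - 2 * h * Lhat) * S) / (μ * h * B * (1 - 2 * Lhat * h)) := by
    rw [show 1 - 2 * h * Lhat = 1 - 2 * Lhat * h by ring]
    generalize 1 - 2 * Lhat * h = c at hc
    have := hc.ne'
    field_simp
  rw [e, e']
  exact div_le_div_of_nonneg_right k2 (by positivity)
end

section
/- Let μ > 0, L̂ ≥ μ, Δ ∈ (0,1), and set κ̂ := L̂/μ, h := Δ / ((4 + 2Δ) L̂). Let m be a positive integer with m ≥ (4/Δ + 2) · log(2/Δ + 2) · κ̂. Then the contraction factor of one S2CD epoch is at most Δ: (1 − μh)^m / ( (1 − (1 − μh)^m)(1 − 2L̂h) ) + 2L̂h / (1 − 2L̂h) ≤ Δ. -/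
/-- The parameter-setting claim of Corollary 3 of the paper: with
`h = Δ / ((4 + 2Δ) L̂)` and `m ≥ (4/Δ + 2) log(2/Δ + 2) κ̂` (where `κ̂ = L̂/μ`),
the contraction factor of one S2CD epoch is at most `Δ`. -/
theorem stmt12 (μ Lhat Δ : ℝ) (hμ : 0 < μ) (hL : μ ≤ Lhat)
    (hΔ : Δ ∈ Set.Ioo (0 : ℝ) 1)
    (κ : ℝ) (hκ : κ = Lhat / μ)
    (h : ℝ) (hh : h = Δ / ((4 + 2 * Δ) * Lhat))
    (m : ℕ) (hm : 0 < m)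
    (hmκ : (4 / Δ + 2) * Real.log (2 / Δ + 2) * κ ≤ (m : ℝ)) :
    (1 - μ * h) ^ m / ((1 - (1 - μ * h) ^ m) * (1 - 2 * Lhat * h))
      + 2 * Lhat * h / (1 - 2 * Lhat * h) ≤ Δ := by
  obtain ⟨h0, h1⟩ := hΔ
  have hLp : 0 < Lhat := lt_of_lt_of_le hμ hL
  have e1 : 2 * Lhat * h = Δ / (2 + Δ) := by
    rw [hh]; field_simp; ring
  have e2 : 1 - Δ / (2 + Δ) = 2 / (2 + Δ) := by
    field_simp; ring
  have hhp : 0 < h := by rw [hh]; positivity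
  have hx : 0 < μ * h := mul_pos hμ hhp
  have hx1 : μ * h ≤ 1 := by
    have a1 : μ * h ≤ Lhat * h := mul_le_mul_of_nonneg_right hL hhp.le
    have a2 : Δ / (2 + Δ) ≤ 1 := by
      rw [div_le_one (by positivity)]; linarith
    linarith
  have e3 : (4 / Δ + 2) * κ * (μ * h) = 1 := by
    rw [hκ, hh]; field_simp
  have hlog : Real.log (2 / Δ + 2) ≤ μ * h * m := by
    have := mul_le_mul_of_nonneg_right hmκ hx.le
    have e4 : (4 / Δ + 2) * Real.log (2 / Δ + 2) * κ * (μ * h) = Real.log (2 / Δ + 2) := by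
      linear_combination Real.log (2 / Δ + 2) * e3
    linarith
  have hq0 : 0 ≤ (1 - μ * h) ^ m := pow_nonneg (by linarith) m
  have hq : (1 - μ * h) ^ m ≤ Δ / (2 + 2 * Δ) := by
    calc (1 - μ * h) ^ m ≤ (Real.exp (-(μ * h))) ^ m :=
          pow_le_pow_left₀ (by linarith) (Real.one_sub_le_exp_neg _) m
      _ = Real.exp (-(μ * h * m)) := by
          rw [← Real.exp_nat_mul]; congr 1; ring
      _ ≤ Real.exp (-Real.log (2 / Δ + 2)) := Real.exp_le_exp.mpr (by linarith)
      _ = Δ / (2 + 2 * Δ) := by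
          rw [Real.exp_neg, Real.exp_log (by positivity)]; field_simp
  generalize (1 - μ * h) ^ m = q at hq hq0 ⊢
  rw [e1, e2]
  rw [le_div_iff₀ (by positivity)] at hq
  have hq1 : 0 < 1 - q := by nlinarith
  have e5 : Δ / (2 + Δ) / (2 / (2 + Δ)) = Δ / 2 := by field_simp
  have e6 : q / ((1 - q) * (2 / (2 + Δ))) ≤ Δ / 2 := by
    rw [div_le_iff₀ (by positivity)]
    have : Δ / 2 * ((1 - q) * (2 / (2 + Δ))) = Δ * (1 - q) / (2 + Δ) := by field_simp
    rw [this, le_div_iff₀ (by positivity)]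
    linarith
  rw [e5]; linarith
end
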